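/- arXiv:2312.01132 — 3 statements merged into one kernel-verified Lean document; each statement's English description precedes it below -/
import Mathlib

section
/- Let ε, μ₁, μ₂, ω₀, z, v be real numbers with z > −1 and D := √2(μ₁+1) + 24π^{3/2}μ₂ ≠ 0, and set P := z(z(z+3)+3). Then the sum of the following five expressions is equal to zero: (i) Ė_field^{10} := (3ε²v/(2D))·[√2(μ₁+1)ω₀(z+1)³ − 12π^{3/2}μ₂(−μ₁ + (μ₁−2ω₀+1)P − 2ω₀ − 1)]/(z+1)⁷; (ii) Ė_field^{00} := −(3(μ₁+1)ε²v/(√2·D²))·[√2(μ₁+1)ω₀(z+1)³ + 12π^{3/2}μ₂(2ω₀ − (μ₁−2ω₀+1)P)]/(z+1)⁷; (iii) Ė_trans := (3ε²v/(2(z+1)⁷))·[P(√2(μ₁+1)ω₀ − 12π^{3/2}μ₂(μ₁−2ω₀+1))/D + ω₀]; (iv) Ė_rot^{(0)} := (36π^{3/2}μ₂ε²v/D²)·[−√2(μ₁+1)ω₀(z+1)³ − 12π^{3/2}μ₂(2ω₀ − (μ₁−2ω₀+1)P)]/(z+1)⁷; (v) Ė_rot^{(1)} := (3ε²v/(2D))·[12π^{3/2}μ₂(−μ₁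 + (μ₁−2ω₀+1)P − 2ω₀ − 1) − √2(μ₁+1)ω₀(z+1)³]/(z+1)⁷. (This is the algebraic content of Proposition 1: along any solution of the dimensionless equations of motion of model A, with z = z₀(t) and v = ż₀(t), the total energy E_field^{10} + E_field^{00} + E_trans^{(0)} + E_rot^{(0)} + E_rot^{(1)} is constant.) -/
/-- Proposition 1 (energy balance of model A, algebraic content): the sum of the five
time-derivative expressions `Ė_field^{10} + Ė_field^{00} + Ė_trans + Ė_rot^{(0)} + Ė_rot^{(1)}`
vanishes. -/
theorem stmt0 (ε μ₁ μ₂ ω₀ z v D P : ℝ)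
    (hz : z > -1)
    (hD : D = Real.sqrt 2 * (μ₁ + 1) + 24 * Real.pi ^ ((3:ℝ)/2) * μ₂)
    (hDne : D ≠ 0)
    (hP : P = z * (z * (z + 3) + 3)) :
    (3 * ε^2 * v / (2 * D)) *
      ((Real.sqrt 2 * (μ₁ + 1) * ω₀ * (z+1)^3
        - 12 * Real.pi ^ ((3:ℝ)/2) * μ₂ * (-μ₁ + (μ₁ - 2*ω₀ + 1) * P - 2*ω₀ - 1)) / (z+1)^7)
    + (-(3 * (μ₁ + 1) * ε^2 * v / (Real.sqrt 2 * D^2)) *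
      ((Real.sqrt 2 * (μ₁ + 1) * ω₀ * (z+1)^3
        + 12 * Real.pi ^ ((3:ℝ)/2) * μ₂ * (2*ω₀ - (μ₁ - 2*ω₀ + 1) * P)) / (z+1)^7))
    + (3 * ε^2 * v / (2 * (z+1)^7)) *
      (P * (Real.sqrt 2 * (μ₁ + 1) * ω₀
            - 12 * Real.pi ^ ((3:ℝ)/2) * μ₂ * (μ₁ - 2*ω₀ + 1)) / D + ω₀)
    + (36 * Real.pi ^ ((3:ℝ)/2) * μ₂ * ε^2 * v / D^2) *
      ((-(Real.sqrt 2 * (μ₁ + 1) * ω₀ * (z+1)^3)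
        - 12 * Real.pi ^ ((3:ℝ)/2) * μ₂ * (2*ω₀ - (μ₁ - 2*ω₀ + 1) * P)) / (z+1)^7)
    + (3 * ε^2 * v / (2 * D)) *
      ((12 * Real.pi ^ ((3:ℝ)/2) * μ₂ * (-μ₁ + (μ₁ - 2*ω₀ + 1) * P - 2*ω₀ - 1)
        - Real.sqrt 2 * (μ₁ + 1) * ω₀ * (z+1)^3) / (z+1)^7)
    = 0 := by
  have hw : z + 1 ≠ 0 := by linarith
  have hs : Real.sqrt 2 ^ 2 = 2 := Real.sq_sqrt (by norm_num)
  have hs0 : Real.sqrt 2 ≠ 0 := by positivity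
  have hdiv : 3 * (μ₁ + 1) * ε^2 * v / (Real.sqrt 2 * D^2)
      = 3 * ε^2 * v * (Real.sqrt 2 * (μ₁ + 1)) / (2 * D^2) := by
    field_simp
    linear_combination (-(ε^2 * v * (μ₁ + 1))) * hs
  rw [hdiv]
  generalize Real.pi ^ ((3:ℝ)/2) = p at *
  generalize Real.sqrt 2 = s at *
  have hW : (z + 1)^3 = P + 1 := by rw [hP]; ring
  rw [hW]
  have hy : (z + 1)^7 ≠ 0 := pow_ne_zero 7 hw
  generalize (z + 1)^7 = y at *
  set B := 12 * p * μ₂ with hB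
  have hA : s * (μ₁ + 1) = D - 2 * B := by rw [hD, hB]; ring
  have hC : 36 * p * μ₂ = 3 * B := by rw [hB]; ring
  rw [hA, hC]
  clear_value B
  clear hD hP hdiv
  field_simp
  ring
end

section
/- Let ε, ω₀ be real, μ₁ > 0, μ₂ > 0, and set D := √2(μ₁+1) + 24π^{3/2}μ₂. Let z₀ : ℝ → ℝ be twice differentiable and ω₊, ω₋ : ℝ → ℝ differentiable, with z₀(t) > −1 for all t, satisfying the system z̈₀(t) = (3μ₁ε²/(2(μ₁+1)))·(ω₋(t) − ω₊(t))/(z₀(t)+1)⁴, ω̇₊(t) = (36π^{3/2}μ₁μ₂/D)·ż₀(t)/(z₀(t)+1)⁴, ω̇₋(t) = −(36π^{3/2}μ₂/D)·ż₀(t)/(z₀(t)+1)⁴, and the initial conditions z₀(0) = 0, ω₊(0) = 0, ω₋(0) = ω₀. Then for all t: z̈₀(t) = (3μ₁ε²/(2(μ₁+1)(z₀(t)+1)⁷))·[ω₀ + z₀(t)(z₀(t)(z₀(t)+3)+3)·(√2(μ₁+1)ω₀ − 12π^{3/2}μ₂(μ₁ − 2ω₀ + 1))/D]. -/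
/-- A function whose derivative is `c * z' / (z + 1) ^ 4` is, up to a constant,
`-c / (3 * (z + 1) ^ 3)`. -/
theorem sub_eq_of_deriv_eq_mul_div_pow_four {c : ℝ} {z w : ℝ → ℝ}
    (hz : Differentiable ℝ z) (hw : Differentiable ℝ w) (hne : ∀ t, z t + 1 ≠ 0)
    (h : ∀ t, deriv w t = c * (deriv z t / (z t + 1) ^ 4)) (s t : ℝ) :
    w t - w s = c / 3 * (((z s + 1) ^ 3)⁻¹ - ((z t + 1) ^ 3)⁻¹) := by
  have hd : ∀ x, HasDerivAt (fun x => w x + c / 3 * ((z x + 1) ^ 3)⁻¹) 0 x := by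
    intro x
    have hx := hne x
    have h₁ := (((hz x).hasDerivAt.add_const 1).fun_pow 3).fun_inv (pow_ne_zero 3 hx)
    refine ((hw x).hasDerivAt.add (h₁.const_mul (c / 3))).congr_deriv ?_
    rw [h x]
    push_cast
    field_simp
    ring
  have hconst := is_const_of_deriv_eq_zero (fun x => (hd x).differentiableAt)
    (fun x => (hd x).deriv) t s
  linear_combination hconst

/-- The dimensionless equations of motion (19)–(21) of model A imply the reduced
second-order equation (22) for the position `z₀` of the small dipole. -/
theorem stmt4 (ε ω₀ μ₁ μ₂ D : ℝ) (hμ₁ : μ₁ > 0) (hμ₂ : μ₂ > 0)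
    (hD : D = Real.sqrt 2 * (μ₁ + 1) + 24 * Real.pi ^ ((3:ℝ)/2) * μ₂)
    (z₀ ωplus ωminus : ℝ → ℝ)
    (hz : Differentiable ℝ z₀) (hz' : Differentiable ℝ (deriv z₀))
    (hwp : Differentiable ℝ ωplus) (hwm : Differentiable ℝ ωminus)
    (hzgt : ∀ t, z₀ t > -1)
    (heom1 : ∀ t, deriv (deriv z₀) t
      = (3 * μ₁ * ε^2 / (2 * (μ₁ + 1))) * ((ωminus t - ωplus t) / (z₀ t + 1)^4))
    (heom2 : ∀ t, deriv ωplus t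
      = (36 * Real.pi ^ ((3:ℝ)/2) * μ₁ * μ₂ / D) * (deriv z₀ t / (z₀ t + 1)^4))
    (heom3 : ∀ t, deriv ωminus t
      = -(36 * Real.pi ^ ((3:ℝ)/2) * μ₂ / D) * (deriv z₀ t / (z₀ t + 1)^4))
    (hic1 : z₀ 0 = 0) (hic2 : ωplus 0 = 0) (hic3 : ωminus 0 = ω₀) :
    ∀ t, deriv (deriv z₀) t
      = (3 * μ₁ * ε^2 / (2 * (μ₁ + 1) * (z₀ t + 1)^7)) *
          (ω₀ + z₀ t * (z₀ t * (z₀ t + 3) + 3) *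
            (Real.sqrt 2 * (μ₁ + 1) * ω₀
              - 12 * Real.pi ^ ((3:ℝ)/2) * μ₂ * (μ₁ - 2*ω₀ + 1)) / D) := by
  intro t
  have hne : ∀ t, z₀ t + 1 ≠ 0 := fun t => by linarith [hzgt t]
  have hp := sub_eq_of_deriv_eq_mul_div_pow_four hz hwp hne heom2 0 t
  have hm := sub_eq_of_deriv_eq_mul_div_pow_four hz hwm hne heom3 0 t
  rw [hic1, hic2] at hp
  rw [hic1, hic3] at hm
  have hD0 : D ≠ 0 := by rw [hD]; positivity
  have hμ : μ₁ + 1 ≠ 0 := by positivity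
  have hu := hne t
  rw [heom1 t, eq_add_of_sub_eq hm, eq_add_of_sub_eq hp]
  generalize Real.pi ^ ((3:ℝ)/2) = P at *
  have hnum : Real.sqrt 2 * (μ₁ + 1) * ω₀ - 12 * P * μ₂ * (μ₁ - 2*ω₀ + 1)
      = D * ω₀ - 12 * P * μ₂ * (μ₁ + 1) := by
    rw [hD]; ring
  rw [hnum]
  clear hnum hD
  field_simp
  ring
end

section
/- Let K > 0 and let z : [0,∞) → ℝ be twice differentiable with z(t) > −1 for all t ≥ 0, z(0) = 0, ż(0) = 0, and z̈(t) = K/(1+z(t))⁴ for all t ≥ 0. Then z(t) → ∞ and ż(t) → √(2K/3) as t → ∞. -/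
open Filter

/-- A function whose derivative is bounded below by a positive constant near infinity tends to
infinity. -/
theorem tendsto_atTop_of_le_deriv {f : ℝ → ℝ} {a c : ℝ} (hc : 0 < c)
    (hf : ∀ t ≥ a, DifferentiableAt ℝ f t) (hle : ∀ t ≥ a, c ≤ deriv f t) :
    Tendsto f atTop atTop := by
  have hlin : Tendsto (fun t => f a + c * (t - a)) atTop atTop :=
    tendsto_atTop_add_const_left _ _
      ((tendsto_atTop_add_const_right atTop (-a) tendsto_id).const_mul_atTop hc)
  refine tendsto_atTop_mono' _ ?_ hlin
  filter_upwards [eventually_ge_atTop a] with t ht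
  have h := (convex_Ici a).mul_sub_le_image_sub_of_le_deriv
    (fun x hx => (hf x hx).continuousAt.continuousWithinAt)
    (fun x hx => (hf x (interior_subset hx)).differentiableWithinAt)
    (fun x hx => hle x (interior_subset hx)) a Set.self_mem_Ici t ht ht
  linarith

/-- Conservation of energy for `z̈ = K / (1 + z)⁴`. -/
theorem sq_deriv_eq_of_deriv_deriv_eq {K : ℝ} {z : ℝ → ℝ}
    (hzgt : ∀ t ≥ (0 : ℝ), z t > -1) (hz0 : z 0 = 0) (hv0 : deriv z 0 = 0)
    (hd1 : ∀ t ≥ (0 : ℝ), DifferentiableAt ℝ z t)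
    (hd2 : ∀ t ≥ (0 : ℝ), DifferentiableAt ℝ (deriv z) t)
    (hode : ∀ t ≥ (0 : ℝ), deriv (deriv z) t = K / (1 + z t) ^ 4) {t : ℝ} (ht : 0 ≤ t) :
    deriv z t ^ 2 = 2 * K / 3 * (1 - ((1 + z t) ^ 3)⁻¹) := by
  have hE : ∀ s ≥ (0 : ℝ),
      HasDerivAt (fun s => deriv z s ^ 2 + 2 * K / 3 * ((1 + z s) ^ 3)⁻¹) 0 s := by
    intro s hs
    have hpos : 1 + z s ≠ 0 := by linarith [hzgt s hs]
    have h := ((hd2 s hs).hasDerivAt.pow 2).add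
      (((((hd1 s hs).hasDerivAt.const_add 1).pow 3).inv (pow_ne_zero 3 hpos)).const_mul
        (2 * K / 3))
    refine h.congr_deriv ?_
    rw [hode s hs]
    simp only [Pi.pow_apply]
    field_simp
    push_cast
    ring
  have h := constant_of_has_deriv_right_zero
    (fun s hs => (hE s hs.1).continuousAt.continuousWithinAt)
    (fun s hs => (hE s hs.1).hasDerivWithinAt) t (Set.right_mem_Icc.2 ht)
  simp only [hz0, hv0] at h
  linarith

/-- The asymptotic behavior of the motion of the small dipole in model B (Appendix B):
if `z̈ = K/(1+z)⁴` on `[0,∞)` with `K > 0`, `z(0) = 0`, `ż(0) = 0`, then `z(t) → ∞` and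
`ż(t) → √(2K/3)` as `t → ∞`. -/
theorem stmt17 (K : ℝ) (hK : K > 0) (z : ℝ → ℝ)
    (hzgt : ∀ t ≥ (0:ℝ), z t > -1)
    (hz0 : z 0 = 0) (hv0 : deriv z 0 = 0)
    (hd1 : ∀ t ≥ (0:ℝ), DifferentiableAt ℝ z t)
    (hd2 : ∀ t ≥ (0:ℝ), DifferentiableAt ℝ (deriv z) t)
    (hode : ∀ t ≥ (0:ℝ), deriv (deriv z) t = K / (1 + z t)^4) :
    Tendsto z atTop atTop ∧ Tendsto (deriv z) atTop (nhds (Real.sqrt (2 * K / 3))) := by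
  have hpos : ∀ t ≥ (0 : ℝ), 0 < 1 + z t := fun t ht => by linarith [hzgt t ht]
  have hmono : StrictMonoOn (deriv z) (Set.Ici 0) :=
    strictMonoOn_of_deriv_pos (convex_Ici 0)
      (fun t ht => (hd2 t ht).continuousAt.continuousWithinAt) fun t ht => by
        rw [hode t (interior_subset ht)]
        exact div_pos hK (pow_pos (hpos t (interior_subset ht)) 4)
  have hv1 : 0 < deriv z 1 := hv0 ▸ hmono Set.self_mem_Ici (Set.mem_Ici.2 zero_le_one) one_pos
  have hz : Tendsto z atTop atTop :=
    tendsto_atTop_of_le_deriv hv1 (fun t ht => hd1 t (zero_le_one.trans ht)) fun t ht =>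
      hmono.monotoneOn (Set.mem_Ici.2 zero_le_one) (Set.mem_Ici.2 (zero_le_one.trans ht)) ht
  refine ⟨hz, ?_⟩
  have hinv : Tendsto (fun t => ((1 + z t) ^ 3)⁻¹) atTop (nhds 0) :=
    ((tendsto_pow_atTop three_ne_zero).comp
      (tendsto_atTop_add_const_left _ 1 hz)).inv_tendsto_atTop
  have hlim := ((hinv.const_sub 1).const_mul (2 * K / 3)).sqrt
  rw [sub_zero, mul_one] at hlim
  refine hlim.congr' ?_
  filter_upwards [eventually_ge_atTop 0] with t ht
  have hvt : 0 ≤ deriv z t := hv0 ▸ hmono.monotoneOn Set.self_mem_Ici (Set.mem_Ici.2 ht) ht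
  rw [← sq_deriv_eq_of_deriv_deriv_eq hzgt hz0 hv0 hd1 hd2 hode ht, Real.sqrt_sq hvt]
end
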